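/- arXiv:math/0506484 — 9 statements merged into one kernel-verified Lean document; each statement's English description precedes it below -/
import Mathlib

section
/- Let p : X → Y be a continuous map between topological spaces, let K ⊆ X be a compact subset, and let U ⊆ X be an open subset with U ⊆ K. If L is a leaf of p which is closed in X, Hausdorff in the subspace topology, and satisfies L ∩ K = L ∩ U ≠ ∅, then L ⊆ U. -/
/-- For a continuous map `p : X → Y`, the leaf of `p` through `x` is the connected
component of `x` in the fiber `p ⁻¹' {p x}`, with the subspace topology. -/
def leafOf {X Y : Type*} [TopologicalSpace X] (p : X → Y) (x : X) : Set X :=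
  connectedComponentIn (p ⁻¹' {p x}) x

/-- Let `p : X → Y` be a continuous map between topological spaces, `K ⊆ X` compact and
`U ⊆ X` open with `U ⊆ K`.  If `L` is a leaf of `p` which is closed in `X`, Hausdorff in
the subspace topology, and satisfies `L ∩ K = L ∩ U ≠ ∅`, then `L ⊆ U`. -/
theorem closed_hausdorff_leaf_subset_of_inter_eq
    {X Y : Type*} [TopologicalSpace X] [TopologicalSpace Y]
    {p : X → Y} (hp : Continuous p) {K U L : Set X}
    (hK : IsCompact K) (hU : IsOpen U) (hUK : U ⊆ K)
    (hleaf : ∃ x : X, L = leafOf p x)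
    (hLclosed : IsClosed L) (hLt2 : T2Space L)
    (hcap : L ∩ K = L ∩ U) (hne : (L ∩ U).Nonempty) :
    L ⊆ U := by
  obtain ⟨x, rfl⟩ := hleaf
  have hconn : PreconnectedSpace (leafOf p x) :=
    isPreconnected_iff_preconnectedSpace.mp isPreconnected_connectedComponentIn
  have hpre : ((↑) : leafOf p x → X) ⁻¹' K = (↑) ⁻¹' U :=
    Subtype.preimage_val_eq_preimage_val_iff _ _ _ |>.mpr hcap
  have hclosed : IsClosed (((↑) : leafOf p x → X) ⁻¹' U) :=
    hpre ▸ (hLclosed.isClosedEmbedding_subtypeVal.isCompact_preimage hK).isClosed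
  have hclopen : IsClopen (((↑) : leafOf p x → X) ⁻¹' U) :=
    ⟨hclosed, hU.preimage continuous_subtype_val⟩
  obtain ⟨y, hyL, hyU⟩ := hne
  have huniv := hclopen.eq_univ ⟨⟨y, hyL⟩, hyU⟩
  exact fun z hz => Set.eq_univ_iff_forall.mp huniv ⟨z, hz⟩
end

section
/- Let X be a locally compact topological space, Y a locally Hausdorff topological space, and p : X → Y a continuous map all of whose leaves are Hausdorff in the subspace topology. Let L be a compact leaf of p which is open in the fiber p⁻¹(y) containing it. Then for every open set V with L ⊆ V there exists an open set U with L ⊆ U ⊆ V such that U is a union of compact leaves of p, i.e., for every x ∈ U the leaf of p through x is compact and contained in U. -/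
/-- A topological space is locally Hausdorff if every point has an open neighbourhood
which is Hausdorff in the subspace topology. -/
def LocallyHausdorff (Y : Type*) [TopologicalSpace Y] : Prop :=
  ∀ y : Y, ∃ U : Set Y, IsOpen U ∧ y ∈ U ∧ T2Space U

theorem IsCompact.isOpen_diff_of_t2Space {Y : Type*} [TopologicalSpace Y] {N S : Set Y}
    (hN : IsOpen N) [T2Space N] (hS : IsCompact S) (hSN : S ⊆ N) : IsOpen (N \ S) := by
  have hS' : IsCompact ((↑) ⁻¹' S : Set N) := by
    rw [Subtype.isCompact_iff, Subtype.image_preimage_coe, Set.inter_eq_right.2 hSN]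
    exact hS
  have h := hN.isOpenMap_subtype_val _ hS'.isClosed.isOpen_compl
  rwa [← Set.preimage_compl, Subtype.image_preimage_coe] at h

theorem IsCompact.inter_connectedComponentIn {X : Type*} [TopologicalSpace X] {F K : Set X}
    (hK : IsCompact K) (hKF : K ⊆ F) (x : X) : IsCompact (connectedComponentIn F x ∩ K) := by
  by_cases hx : x ∈ F
  · have hK' : IsCompact ((↑) ⁻¹' K : Set F) := by
      rw [Subtype.isCompact_iff, Subtype.image_preimage_coe, Set.inter_eq_right.2 hKF]
      exact hK
    rw [connectedComponentIn_eq_image hx, ← Set.image_inter_preimage]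
    exact (hK'.inter_left isClosed_connectedComponent).image continuous_subtype_val
  · simp [connectedComponentIn_eq_empty hx]

theorem IsPreconnected.subset_of_isCompact_inter {X : Type*} [TopologicalSpace X]
    {C K O : Set X} (hC : IsPreconnected C) [T2Space C] (hK : IsCompact (C ∩ K))
    (hO : IsOpen O) (hKO : C ∩ K = C ∩ O) (hne : (C ∩ K).Nonempty) : C ⊆ K := by
  have : PreconnectedSpace C := isPreconnected_iff_preconnectedSpace.1 hC
  have hclosed : IsClosed ((↑) ⁻¹' K : Set C) := by
    refine IsCompact.isClosed ?_
    rwa [Subtype.isCompact_iff, Subtype.image_preimage_coe]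
  have hopen : IsOpen ((↑) ⁻¹' K : Set C) := by
    rw [Subtype.preimage_coe_eq_preimage_coe_iff.2 hKO]
    exact hO.preimage continuous_subtype_val
  obtain ⟨x, hxC, hxK⟩ := hne
  have huniv := IsClopen.eq_univ ⟨hclosed, hopen⟩ ⟨⟨x, hxC⟩, hxK⟩
  exact fun z hz => huniv.symm.subset (Set.mem_univ (⟨z, hz⟩ : C))

/-- Reeb stability for a continuous function: let `X` be locally compact, `Y` locally
Hausdorff and `p : X → Y` continuous with Hausdorff leaves.  If `L` is a compact leaf of
`p` which is open in its fiber, then every open neighbourhood `V` of `L` contains an open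
neighbourhood `U` of `L` which is a union of compact leaves of `p`. -/
theorem reeb_stability_continuous_map
    {X Y : Type*} [TopologicalSpace X] [TopologicalSpace Y]
    [LocallyCompactSpace X] (hY : LocallyHausdorff Y)
    {p : X → Y} (hp : Continuous p)
    (hleaves : ∀ x : X, T2Space (leafOf p x))
    {x₀ : X} (hLcompact : IsCompact (leafOf p x₀))
    (hLopen : IsOpen ((Subtype.val) ⁻¹' (leafOf p x₀) : Set (p ⁻¹' {p x₀})))
    {V : Set X} (hV : IsOpen V) (hLV : leafOf p x₀ ⊆ V) :
    ∃ U : Set X, IsOpen U ∧ leafOf p x₀ ⊆ U ∧ U ⊆ V ∧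
      ∀ x ∈ U, IsCompact (leafOf p x) ∧ leafOf p x ⊆ U := by
  obtain ⟨N, hN, hyN, hT2⟩ := hY (p x₀)
  obtain ⟨W, hW, hWL⟩ := isOpen_induced_iff.1 hLopen
  have hWL' : p ⁻¹' {p x₀} ∩ W = p ⁻¹' {p x₀} ∩ leafOf p x₀ :=
    Subtype.preimage_coe_eq_preimage_coe_iff.1 hWL
  have hLfiber : leafOf p x₀ ⊆ p ⁻¹' {p x₀} := connectedComponentIn_subset _ _
  have hL : leafOf p x₀ ⊆ V ∩ W ∩ p ⁻¹' N := fun x hx => by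
    have hpx : p x = p x₀ := hLfiber hx
    exact ⟨⟨hLV hx, (hWL'.symm.subset ⟨hLfiber hx, hx⟩).2⟩, by simpa [hpx] using hyN⟩
  obtain ⟨K, hK, hLK, hKV⟩ := exists_compact_between hLcompact
    ((hV.inter hW).inter (hN.preimage hp)) hL
  have hB : IsCompact (p '' (K \ interior K)) := (hK.diff isOpen_interior).image hp
  have hBN : p '' (K \ interior K) ⊆ N := Set.image_subset_iff.2 fun x hx => (hKV hx.1).2
  have hN' := hB.isOpen_diff_of_t2Space hN hBN
  have hint : ∀ x ∈ K, p x ∉ p '' (K \ interior K) → x ∈ interior K := fun x hxK hx => by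
    by_contra hxi
    exact hx ⟨x, ⟨hxK, hxi⟩, rfl⟩
  refine ⟨interior K ∩ p ⁻¹' (N \ p '' (K \ interior K)),
    isOpen_interior.inter (hN'.preimage hp), fun x hx => ⟨hLK hx, (hL hx).2, ?_⟩,
    fun x hx => (hKV (interior_subset hx.1)).1.1, ?_⟩
  · rintro ⟨z, ⟨hzK, hzi⟩, hzx⟩
    have hz : z ∈ p ⁻¹' {p x₀} := hzx.trans (hLfiber hx)
    exact hzi (hLK (hWL'.subset ⟨hz, (hKV hzK).1.2⟩).2)
  · rintro x ⟨hxi, hxN, hxB⟩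
    have hCfiber : leafOf p x ⊆ p ⁻¹' {p x} := connectedComponentIn_subset _ _
    have hxC : x ∈ leafOf p x := mem_connectedComponentIn rfl
    have hfiber : IsCompact (K ∩ p ⁻¹' {p x}) := by
      have hdiff := hK.diff ((isCompact_singleton.isOpen_diff_of_t2Space hN
        (Set.singleton_subset_iff.2 hxN)).preimage hp)
      convert hdiff using 1
      ext z
      constructor
      · exact fun hz => ⟨hz.1, fun h => h.2 hz.2⟩
      · exact fun hz => ⟨hz.1, by_contra fun h => hz.2 ⟨(hKV hz.1).2, h⟩⟩
    have hCK : IsCompact (leafOf p x ∩ (K ∩ p ⁻¹' {p x})) :=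
      hfiber.inter_connectedComponentIn Set.inter_subset_right x
    have hmem : ∀ z ∈ leafOf p x, z ∈ K → z ∈ interior K := fun z hz hzK =>
      hint z hzK (by rwa [show p z = p x from hCfiber hz])
    have hT2C := hleaves x
    have hsub : leafOf p x ⊆ K ∩ p ⁻¹' {p x} := by
      have hC : IsPreconnected (leafOf p x) := isPreconnected_connectedComponentIn
      refine hC.subset_of_isCompact_inter hCK
        (isOpen_interior (s := K)) ?_ ⟨x, hxC, interior_subset hxi, rfl⟩
      ext z
      exact ⟨fun hz => ⟨hz.1, hmem z hz.1 hz.2.1⟩,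
        fun hz => ⟨hz.1, interior_subset hz.2, hCfiber hz.1⟩⟩
    refine ⟨by rwa [Set.inter_eq_left.2 hsub] at hCK, fun z hz => ⟨hmem z hz (hsub hz).1, ?_⟩⟩
    rw [Set.mem_preimage, show p z = p x from hCfiber hz]
    exact ⟨hxN, hxB⟩
end

section
/- Let X be a locally compact topological space, Y a locally Hausdorff topological space, and p : X → Y a continuous map such that every fiber of p is locally connected and Hausdorff in the subspace topology. Let L be a compact leaf of p. Then for every open set V with L ⊆ V there exists an open set U with L ⊆ U ⊆ V such that U is a union of compact leaves of p, i.e., for every x ∈ U the leaf of p through x is compact and contained in U. -/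
/-- A compact subset of an open Hausdorff subspace is relatively closed in it. -/
theorem IsOpen.diff_isCompact_of_t2Space {Y : Type*} [TopologicalSpace Y] {H C : Set Y}
    (hH : IsOpen H) [T2Space H] (hC : IsCompact C) (hCH : C ⊆ H) : IsOpen (H \ C) := by
  have hcpt : IsCompact ((↑) ⁻¹' C : Set H) :=
    (Topology.IsInducing.subtypeVal.isCompact_preimage_iff (by simpa using hCH)).2 hC
  have h := hH.isOpenMap_subtype_val _ hcpt.isClosed.isOpen_compl
  rwa [← Set.preimage_compl, Subtype.image_preimage_coe, ← Set.sdiff_eq] at h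

/-- In a Hausdorff subspace `F`, a relatively open set with compact trace `K ∩ F` contains the
components in `F` of its points, and these components are compact. -/
theorem isCompact_connectedComponentIn_of_inter_eq {X : Type*} [TopologicalSpace X]
    {F K W : Set X} [T2Space F] (hW : IsOpen W) (hWK : F ∩ W = F ∩ K) (hK : IsCompact (F ∩ K))
    {x : X} (hxF : x ∈ F) (hxK : x ∈ K) :
    IsCompact (connectedComponentIn F x) ∧ connectedComponentIn F x ⊆ F ∩ K := by
  have hpre : ((↑) ⁻¹' K : Set F) = (↑) ⁻¹' (F ∩ K) := by simp
  have hcpt : IsCompact ((↑) ⁻¹' K : Set F) := by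
    rw [hpre]
    exact (Topology.IsInducing.subtypeVal.isCompact_preimage_iff (by simp)).2 hK
  have hopen : IsOpen ((↑) ⁻¹' K : Set F) := by
    rw [hpre, ← hWK, Subtype.preimage_coe_self_inter]
    exact hW.preimage continuous_subtype_val
  have hsub : connectedComponent (⟨x, hxF⟩ : F) ⊆ (↑) ⁻¹' K :=
    IsClopen.connectedComponent_subset ⟨hcpt.isClosed, hopen⟩ hxK
  rw [connectedComponentIn_eq_image hxF]
  refine ⟨(hcpt.of_isClosed_subset isClosed_connectedComponent hsub).image
    continuous_subtype_val, ?_⟩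
  rintro _ ⟨z, hz, rfl⟩
  exact ⟨z.2, hsub hz⟩

/-- A component of a locally connected subspace is relatively open. -/
theorem exists_isOpen_inter_eq_connectedComponentIn {X : Type*} [TopologicalSpace X]
    {F : Set X} [LocallyConnectedSpace F] {x : X} (hx : x ∈ F) :
    ∃ W : Set X, IsOpen W ∧ F ∩ W = connectedComponentIn F x := by
  obtain ⟨W, hW, hWeq⟩ := isOpen_induced_iff.1 (isOpen_connectedComponent (x := (⟨x, hx⟩ : F)))
  refine ⟨W, hW, ?_⟩
  rw [connectedComponentIn_eq_image hx, ← hWeq, Subtype.image_preimage_coe]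

/-- Reeb stability for a continuous function with locally connected Hausdorff fibers:
let `X` be locally compact, `Y` locally Hausdorff, and `p : X → Y` continuous such that
every fiber of `p` is locally connected and Hausdorff in the subspace topology.  If `L`
is a compact leaf of `p`, then every open neighbourhood `V` of `L` contains an open
neighbourhood `U` of `L` which is a union of compact leaves of `p`. -/
theorem reeb_stability_continuous_map_of_locallyConnected_fibers
    {X Y : Type*} [TopologicalSpace X] [TopologicalSpace Y]
    [LocallyCompactSpace X] (hY : LocallyHausdorff Y)
    {p : X → Y} (hp : Continuous p)
    (hfibersT2 : ∀ y : Y, T2Space (p ⁻¹' {y}))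
    (hfibersLC : ∀ y : Y, LocallyConnectedSpace (p ⁻¹' {y}))
    {x₀ : X} (hLcompact : IsCompact (leafOf p x₀))
    {V : Set X} (hV : IsOpen V) (hLV : leafOf p x₀ ⊆ V) :
    ∃ U : Set X, IsOpen U ∧ leafOf p x₀ ⊆ U ∧ U ⊆ V ∧
      ∀ x ∈ U, IsCompact (leafOf p x) ∧ leafOf p x ⊆ U := by
  obtain ⟨H, hH, hx₀H, hHT2⟩ := hY (p x₀)
  have := hfibersLC (p x₀)
  obtain ⟨W, hW, hWL⟩ :=
    exists_isOpen_inter_eq_connectedComponentIn (F := p ⁻¹' {p x₀}) (x := x₀) rfl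
  change _ = leafOf p x₀ at hWL
  have hLW : leafOf p x₀ ⊆ W := hWL ▸ Set.inter_subset_right
  have hLfiber : leafOf p x₀ ⊆ p ⁻¹' {p x₀} := connectedComponentIn_subset _ _
  have hLH : leafOf p x₀ ⊆ p ⁻¹' H := fun x hx => by
    have hpx : p x = p x₀ := hLfiber hx
    simpa [hpx] using hx₀H
  obtain ⟨K, hK, hLK, hKsub⟩ := exists_compact_between hLcompact
    ((hV.inter hW).inter (hH.preimage hp))
    (Set.subset_inter (Set.subset_inter hLV hLW) hLH)
  have hKH : Set.MapsTo p K H := fun x hx => (hKsub hx).2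
  have hO : IsOpen (H \ p '' (K \ interior K)) :=
    hH.diff_isCompact_of_t2Space ((hK.diff isOpen_interior).image hp)
      (hKH.mono_left Set.sdiff_subset).image_subset
  refine ⟨interior K ∩ p ⁻¹' (H \ p '' (K \ interior K)),
    isOpen_interior.inter (hO.preimage hp), fun x hx => ⟨hLK hx, hLH hx, ?_⟩,
    fun x hx => (hKsub (interior_subset hx.1)).1.1, fun x hx => ?_⟩
  · rintro ⟨z, hz, hzx⟩
    have hzL : z ∈ leafOf p x₀ := hWL ▸ ⟨hzx.trans (hLfiber hx), (hKsub hz.1).1.2⟩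
    exact hz.2 (hLK hzL)
  · have := hfibersT2 (p x)
    have hFK : p ⁻¹' {p x} ∩ interior K = p ⁻¹' {p x} ∩ K := by
      refine Set.Subset.antisymm (Set.inter_subset_inter_right _ interior_subset) ?_
      rintro z ⟨hzF, hzK⟩
      refine ⟨hzF, by_contra fun hzi => hx.2.2 ⟨z, ⟨hzK, hzi⟩, hzF⟩⟩
    have hFKcompact : IsCompact (p ⁻¹' {p x} ∩ K) := by
      have h := hK.diff ((hH.diff_isCompact_of_t2Space (isCompact_singleton (x := p x))
        (Set.singleton_subset_iff.2 hx.2.1)).preimage hp)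
      convert h using 1
      ext z
      have := @hKH z
      simp only [Set.mem_inter_iff, Set.mem_preimage, Set.mem_sdiff]
      tauto
    obtain ⟨hcpt, hsub⟩ := isCompact_connectedComponentIn_of_inter_eq (x := x) isOpen_interior hFK
      hFKcompact rfl (interior_subset hx.1)
    refine ⟨hcpt, fun z hz => ?_⟩
    obtain ⟨hzF, hzi⟩ := hFK ▸ hsub hz
    have hpz : p z = p x := hzF
    refine ⟨hzi, ?_⟩
    rw [Set.mem_preimage, hpz]
    exact hx.2
end

section
/- Let G be a group generated by a finite subset B with 1 ∈ B and B = B⁻¹. Then there exists a non-trivial group homomorphism from G to the additive group (ℝ, +) if and only if for every ε > 0 and every integer l ≥ 1 there exists a normed (B^l, ε)-approximate representation of G in ℝ. -/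
open scoped Pointwise

/-- In a group generated by a symmetric set `B` containing `1`, each element lies in `B ^ n` for
all large `n`. -/
theorem eventually_mem_pow_of_closure_eq_top {G : Type*} [Group G] {B : Set G}
    (h1 : 1 ∈ B) (hinv : ∀ g ∈ B, g⁻¹ ∈ B) (hgen : Subgroup.closure B = ⊤) (g : G) :
    ∀ᶠ n : ℕ in Filter.atTop, g ∈ B ^ n := by
  suffices h : ∃ k : ℕ, g ∈ B ^ k by
    obtain ⟨k, hk⟩ := h
    filter_upwards [Filter.eventually_ge_atTop k] with n hn
    exact Set.pow_subset_pow_right h1 hn hk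
  have hg : g ∈ Subgroup.closure B := hgen ▸ Subgroup.mem_top g
  induction hg using Subgroup.closure_induction with
  | mem x hx => exact ⟨1, by simpa using hx⟩
  | one => exact ⟨0, by simp⟩
  | mul x y _ _ hx hy =>
    obtain ⟨k, hk⟩ := hx
    obtain ⟨m, hm⟩ := hy
    exact ⟨k + m, pow_add B k m ▸ Set.mul_mem_mul hk hm⟩
  | inv x _ hx =>
    obtain ⟨k, hk⟩ := hx
    refine ⟨k, Set.pow_subset_pow_left (s := B⁻¹) (fun y hy => ?_) ?_⟩
    · simpa using hinv _ hy
    · simpa [inv_pow] using hk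

/-- A sequence of functions on a group that is asymptotically additive and eventually bounded by `1`
at each point of a generating set has an additive pointwise limit along any ultrafilter. -/
theorem exists_additive_tendsto_of_asymptotically_additive {G ι : Type*} [Group G] {B : Set G}
    (hgen : Subgroup.closure B = ⊤) (U : Ultrafilter ι) (η : ι → G → ℝ)
    (hadd : ∀ a b : G, Filter.Tendsto (fun i => η i (a * b) - η i a - η i b) U (nhds 0))
    (hB : ∀ g ∈ B, ∀ᶠ i in U, |η i g| ≤ 1) :
    ∃ f : G → ℝ, (∀ a b : G, f (a * b) = f a + f b) ∧
      ∀ g, Filter.Tendsto (fun i => η i g) U (nhds (f g)) := by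
  have hlim : ∀ g, ∃ x : ℝ, Filter.Tendsto (fun i => η i g) U (nhds x) := by
    intro g
    have hone : Filter.Tendsto (fun i => η i 1) U (nhds 0) := by
      simpa using (hadd 1 1).neg
    have hg : g ∈ Subgroup.closure B := hgen ▸ Subgroup.mem_top g
    induction hg using Subgroup.closure_induction with
    | mem x hx =>
      obtain ⟨y, -, hy⟩ := (isCompact_Icc (a := (-1 : ℝ)) (b := 1)).ultrafilter_le_nhds'
        (U.map fun i => η i x) (by
          change ∀ᶠ i in U, η i x ∈ Set.Icc (-1 : ℝ) 1
          filter_upwards [hB x hx] with i hi using abs_le.1 hi)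
      exact ⟨y, hy⟩
    | one => exact ⟨0, hone⟩
    | mul x y _ _ hx hy =>
      obtain ⟨a, ha⟩ := hx
      obtain ⟨b, hb⟩ := hy
      exact ⟨_, (((hadd x y).add ha).add hb).congr fun i => by ring⟩
    | inv x _ hx =>
      obtain ⟨a, ha⟩ := hx
      refine ⟨_, ((hone.sub (hadd x x⁻¹)).sub ha).congr fun i => ?_⟩
      rw [mul_inv_cancel]
      ring
  choose f hf using hlim
  refine ⟨f, fun a b => ?_, hf⟩
  have := tendsto_nhds_unique (hadd a b) (((hf (a * b)).sub (hf a)).sub (hf b))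
  linarith

/-- Thurston's lemma: let `G` be a group generated by a finite subset `B` with `1 ∈ B` and
`B = B⁻¹`.  Then non-trivial homomorphisms `G → (ℝ, +)` exist if and only if for every
`ε > 0` and every integer `l ≥ 1` there exists a normed `(Bˡ, ε)`-approximate
representation of `G` in `ℝ`. -/
theorem nontrivial_real_hom_iff_normed_approximate_representations
    {G : Type*} [Group G] (B : Finset G)
    (h1 : (1 : G) ∈ B) (hinv : ∀ g ∈ B, g⁻¹ ∈ B)
    (hgen : Subgroup.closure (B : Set G) = ⊤) :
    (∃ f : G → ℝ, (∀ a b : G, f (a * b) = f a + f b) ∧ ∃ g : G, f g ≠ 0) ↔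
      (∀ ε : ℝ, 0 < ε → ∀ l : ℕ, 1 ≤ l → ∃ η : G → ℝ,
        (∀ g g' : G, g ∈ (B : Set G) ^ l → g' ∈ (B : Set G) ^ l →
          g' * g ∈ (B : Set G) ^ l → |η (g' * g) - η g' - η g| ≤ ε) ∧
        (∀ g ∈ B, |η g| ≤ 1) ∧ (∃ g ∈ B, |η g| = 1)) := by
  constructor
  · rintro ⟨f, hf, g, hg⟩ ε hε l -
    obtain ⟨b, hb, hmax⟩ := B.exists_max_image (fun x => |f x|) ⟨1, h1⟩
    have hb0 : 0 < |f b| := by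
      by_contra hle
      have hB0 : ∀ x ∈ B, f x = 0 := fun x hx =>
        abs_nonpos_iff.1 ((hmax x hx).trans (not_lt.1 hle))
      let F : G →* Multiplicative ℝ := MonoidHom.mk' (fun x => Multiplicative.ofAdd (f x))
        fun x y => by rw [hf, ofAdd_add]
      have hF : F = 1 := MonoidHom.eq_of_eqOn_dense hgen fun x hx =>
        congrArg Multiplicative.ofAdd (hB0 x hx)
      exact hg (congrArg Multiplicative.toAdd (DFunLike.congr_fun hF g))
    refine ⟨fun x => f x / |f b|, fun x y _ _ _ => ?_, fun x hx => ?_, b, hb, ?_⟩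
    · beta_reduce
      rw [hf, add_div, add_sub_cancel_left, sub_self, abs_zero]
      exact hε.le
    · rw [abs_div, abs_abs]
      exact div_le_one_of_le₀ (hmax x hx) hb0.le
    · rw [abs_div, abs_abs, div_self hb0.ne']
  · intro h
    choose η hadd hle hone using fun n : ℕ =>
      h (1 / ((n : ℝ) + 1)) Nat.one_div_pos_of_nat (n + 1) n.succ_pos
    have hmem (g : G) : ∀ᶠ n : ℕ in Filter.atTop, g ∈ (B : Set G) ^ (n + 1) :=
      (Filter.tendsto_add_atTop_nat 1).eventually
        (eventually_mem_pow_of_closure_eq_top h1 hinv hgen g)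
    let U : Ultrafilter ℕ := Ultrafilter.of Filter.atTop
    have hU : (U : Filter ℕ) ≤ Filter.atTop := Ultrafilter.of_le _
    obtain ⟨f, hf, hlim⟩ := exists_additive_tendsto_of_asymptotically_additive hgen U η
      (fun a b => Filter.Tendsto.mono_left (squeeze_zero_norm' (by
        filter_upwards [hmem a, hmem b, hmem (a * b)] with n ha hb hab
        exact hadd n b a hb ha hab) tendsto_one_div_add_atTop_nhds_zero_nat) hU)
      (fun g hg => Filter.Eventually.of_forall fun n => hle n g hg)
    refine ⟨f, hf, ?_⟩
    by_contra! hf0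
    have hsmall : ∀ᶠ n in (U : Filter ℕ), ∀ g ∈ B, |η n g| < 1 :=
      (Filter.eventually_all_finset B).2 fun g _ =>
        (hlim g).abs.eventually_lt_const (by simp [hf0 g])
    obtain ⟨n, hn⟩ := hsmall.exists
    obtain ⟨g, hg, hg1⟩ := hone n
    exact (hn g hg).ne hg1
end

section
/- Let A be an associative unital ring equipped with a norm ‖·‖ on its underlying additive group, let G be a group, B ⊆ G a finite subset with 1 ∈ B and B = B⁻¹, l ≥ 1 an integer, and δ > 0. Let R : G → A be multiplicative, i.e., R(g'g) = R(g')R(g) for all g, g' ∈ G and R(1) = 1, and suppose that ‖(R(g') − 1)·R(g) − (R(g') − 1)‖ ≤ δ·‖R(g) − 1‖ for all g, g' ∈ B^l. Set M = max_{g ∈ B} ‖R(g) − 1‖. Then: (i) for every integer k with 1 ≤ k ≤ l and every g ∈ B^k one has ‖R(g) − 1‖ ≤ ((k−1)δ + k)·M; and (ii) for all g, g' ∈ B^l with g'g ∈ B^l one has ‖R(g'g) − R(g') − R(g) + 1‖ ≤ ((l−1)δ + l)·δ·M. -/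
open scoped Pointwise

/-- Key estimates for approximate representations: let `A` be a unital ring equipped with
a norm `nA` on its additive group, `G` a group, `B ⊆ G` a finite symmetric generating set
containing `1`, `l ≥ 1`, `δ > 0`, and `R : G → A` multiplicative.  If
`‖(R g' − 1) * R g − (R g' − 1)‖ ≤ δ * ‖R g − 1‖` for all `g, g' ∈ Bˡ`, and
`M = max_{g ∈ B} ‖R g − 1‖`, then
(i) `‖R g − 1‖ ≤ ((k−1)δ + k) * M` for `1 ≤ k ≤ l` and `g ∈ Bᵏ`, and
(ii) `‖R (g' * g) − R g' − R g + 1‖ ≤ ((l−1)δ + l) * δ * M` for `g, g', g' * g ∈ Bˡ`. -/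
theorem approximate_representation_estimates
    {A : Type*} [Ring A] (nA : A → ℝ)
    (hnA_nonneg : ∀ x : A, 0 ≤ nA x)
    (hnA_zero : ∀ x : A, nA x = 0 ↔ x = 0)
    (hnA_add : ∀ x y : A, nA (x + y) ≤ nA x + nA y)
    (hnA_neg : ∀ x : A, nA (-x) = nA x)
    {G : Type*} [Group G] (B : Finset G)
    (h1 : (1 : G) ∈ B) (hinv : ∀ g ∈ B, g⁻¹ ∈ B)
    (l : ℕ) (hl : 1 ≤ l) (δ : ℝ) (hδ : 0 < δ)
    (R : G → A) (hR1 : R 1 = 1)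
    (hRmul : ∀ g g' : G, R (g' * g) = R g' * R g)
    (hest : ∀ g ∈ (B : Set G) ^ l, ∀ g' ∈ (B : Set G) ^ l,
      nA ((R g' - 1) * R g - (R g' - 1)) ≤ δ * nA (R g - 1))
    (M : ℝ) (hM : M = B.sup' ⟨1, h1⟩ fun g => nA (R g - 1)) :
    (∀ k : ℕ, 1 ≤ k → k ≤ l → ∀ g ∈ (B : Set G) ^ k,
        nA (R g - 1) ≤ (((k : ℝ) - 1) * δ + k) * M) ∧
    (∀ g ∈ (B : Set G) ^ l, ∀ g' ∈ (B : Set G) ^ l, g' * g ∈ (B : Set G) ^ l →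
        nA (R (g' * g) - R g' - R g + 1) ≤ (((l : ℝ) - 1) * δ + l) * δ * M) := by
  have hdefect : ∀ g g' : G,
      R (g' * g) - R g' - R g + 1 = (R g' - 1) * R g - (R g' - 1) := by
    intro g g'
    rw [hRmul, sub_mul, one_mul]
    abel
  have hB : ∀ g ∈ B, nA (R g - 1) ≤ M := fun g hg => by
    rw [hM]
    exact Finset.le_sup' (fun g => nA (R g - 1)) hg
  have hone : (1 : G) ∈ (B : Set G) := h1
  have hgrowth : ∀ k : ℕ, 1 ≤ k → k ≤ l → ∀ g ∈ (B : Set G) ^ k,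
      nA (R g - 1) ≤ (((k : ℝ) - 1) * δ + k) * M := by
    intro k hk
    induction k, hk using Nat.le_induction with
    | base =>
      intro _ g hg
      rw [pow_one] at hg
      simpa using hB g hg
    | succ k hk ih =>
      intro hkl g hg
      rw [pow_succ] at hg
      obtain ⟨g', hg', b, hb, rfl⟩ := Set.mem_mul.mp hg
      have hg'l : g' ∈ (B : Set G) ^ l :=
        Set.pow_subset_pow_right hone (Nat.le_of_succ_le hkl) hg'
      have hbl : b ∈ (B : Set G) ^ l :=
        Set.pow_subset_pow_right hone hl (by rwa [pow_one])
      have hsplit : R (g' * b) - 1 =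
          ((R g' - 1) * R b - (R g' - 1)) + ((R g' - 1) + (R b - 1)) := by
        rw [← hdefect]
        abel
      have hbM : nA (R b - 1) ≤ M := hB b hb
      calc nA (R (g' * b) - 1)
          ≤ nA ((R g' - 1) * R b - (R g' - 1)) + (nA (R g' - 1) + nA (R b - 1)) := by
            rw [hsplit]
            exact (hnA_add _ _).trans (by gcongr; exact hnA_add _ _)
        _ ≤ δ * M + ((((k : ℝ) - 1) * δ + k) * M + M) := by
            gcongr
            · exact (hest b hbl g' hg'l).trans (by gcongr)
            · exact ih (Nat.le_of_succ_le hkl) g' hg'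
        _ = ((((k + 1 : ℕ) : ℝ) - 1) * δ + ((k + 1 : ℕ) : ℝ)) * M := by
            push_cast
            ring
  refine ⟨hgrowth, fun g hg g' hg' _ => ?_⟩
  rw [hdefect]
  calc nA ((R g' - 1) * R g - (R g' - 1))
      ≤ δ * nA (R g - 1) := hest g hg g' hg'
    _ ≤ δ * ((((l : ℝ) - 1) * δ + l) * M) := by
        gcongr
        exact hgrowth l hl le_rfl g hg
    _ = (((l : ℝ) - 1) * δ + l) * δ * M := by ring
end

section
/- Let E be a real Banach space and G a finitely generated group, and for each g ∈ G let f_g : E → E be a map which is continuously differentiable on a neighbourhood of 0, satisfies f_g(0) = 0, and whose Fréchet derivative at 0 is the identity map of E. Assume that f_1 coincides with the identity on a neighbourhood of 0 and that, for all g, h ∈ G, the composite f_g ∘ f_h coincides with f_{gh} on a neighbourhood of 0. If every group homomorphism from G to the additive group (ℝ, +) is trivial, then for every g ∈ G the map f_g coincides with the identity on a neighbourhood of 0. -/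
open Filter Topology Asymptotics

section GermRepresentation

variable {E G : Type*} [NormedAddCommGroup E] [Group G] {f : G → E → E}

/-- For maps tangent to the identity, the displacement `x ↦ f g x - x` is additive in `g` up to
an error that is negligible with respect to the displacement of the second factor. -/
theorem displacement_mul_sub_isLittleO [NormedSpace ℝ E]
    (hf : ∀ g, HasStrictFDerivAt (f g) (ContinuousLinearMap.id ℝ E) 0)
    (hzero : ∀ g, f g 0 = 0) (hmul : ∀ g h, (f g ∘ f h) =ᶠ[𝓝 0] f (g * h)) (g h : G) :
    (fun x ↦ (f (g * h) x - x) - (f g x - x) - (f h x - x)) =o[𝓝 0] fun x ↦ f h x - x := by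
  have ht : Tendsto (fun x ↦ (f h x, x)) (𝓝 0) (𝓝 ((0 : E), (0 : E))) := by
    have hc := (hf h).continuousAt.tendsto
    rw [hzero h] at hc
    exact hc.prodMk_nhds tendsto_id
  refine ((hf g).isLittleO.comp_tendsto ht).congr' ?_ EventuallyEq.rfl
  filter_upwards [hmul g h] with x hx
  simp only [Function.comp_apply, ContinuousLinearMap.id_apply] at hx ⊢
  rw [hx]
  abel

/-- If the displacements of a generating set are dominated by `v`, so are all displacements. -/
theorem displacement_isBigO_of_closure_eq_top {F : Type*} [Norm F] {l : Filter E} {v : E → F}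
    (hl : l ≤ 𝓝 0) (hone : f 1 =ᶠ[𝓝 0] id)
    (hadd : ∀ g h, (fun x ↦ (f (g * h) x - x) - (f g x - x) - (f h x - x)) =o[𝓝 0]
      fun x ↦ f h x - x)
    {S : Set G} (hS : Subgroup.closure S = ⊤) (hv : ∀ s ∈ S, (fun x ↦ f s x - x) =O[l] v) (g : G) :
    (fun x ↦ f g x - x) =O[l] v := by
  have hone' : (fun x ↦ f 1 x - x) =ᶠ[l] 0 := by
    filter_upwards [hl hone] with x hx
    simp [hx]
  have hone_isBigO : (fun x ↦ f 1 x - x) =O[l] v :=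
    hone'.trans_isBigO (isBigO_zero v l)
  have hg : g ∈ Subgroup.closure S := hS ▸ Subgroup.mem_top g
  induction hg using Subgroup.closure_induction with
  | mem s hs => exact hv s hs
  | one => exact hone_isBigO
  | mul a b _ _ ha hb =>
    refine ((((hadd a b).mono hl).isBigO.trans hb).add (ha.add hb)).congr_left fun x ↦ ?_
    abel
  | inv a _ ha =>
    have h := ((hadd a⁻¹ a).mono hl).isBigO.trans ha
    rw [inv_mul_cancel] at h
    refine ((hone_isBigO.sub h).sub ha).congr_left fun x ↦ ?_
    abel

end GermRepresentation

/-- Among finitely many real functions, one is eventually the largest along an ultrafilter. -/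
theorem Ultrafilter.exists_eventually_forall_le {α ι : Type*} (U : Ultrafilter α) {S : Set ι}
    (hS : S.Finite) (hne : S.Nonempty) (u : ι → α → ℝ) :
    ∃ s ∈ S, ∀ᶠ x in U, ∀ t ∈ S, u t x ≤ u s x := by
  refine (Ultrafilter.finite_biUnion_mem_iff hS
    (s := fun s ↦ {x | ∀ t ∈ S, u t x ≤ u s x})).1 (univ_mem' fun x ↦ ?_)
  obtain ⟨s, hs, hmax⟩ := S.exists_max_image (fun s ↦ u s x) hS hne
  exact Set.mem_biUnion hs hmax

/-- A real function that is bounded along an ultrafilter converges along it. -/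
theorem Ultrafilter.exists_tendsto_of_isBigO_one {α : Type*} (U : Ultrafilter α) {u : α → ℝ}
    (hu : u =O[(U : Filter α)] fun _ ↦ (1 : ℝ)) : ∃ a, Tendsto u U (𝓝 a) := by
  obtain ⟨C, hC⟩ := hu.bound
  obtain ⟨a, -, ha⟩ := (isCompact_closedBall (0 : ℝ) C).ultrafilter_le_nhds (U.map u) <| by
    rw [Ultrafilter.coe_map, le_principal_iff]
    refine mem_map.2 (hC.mono fun x hx ↦ ?_)
    simpa using hx
  exact ⟨a, ha⟩


/-- Infinite-dimensional Reeb–Schweitzer–Thurston rigidity: let `E` be a real Banach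
space, `G` a finitely generated group, and `(f g)_{g ∈ G}` a family of maps `E → E`
which are continuously differentiable near `0`, fix `0`, have derivative the identity
at `0`, and define a representation of `G` by germs at `0` (i.e. `f 1` is the identity
near `0` and `f g ∘ f h` agrees with `f (g * h)` near `0`).  If every group homomorphism
`G → (ℝ, +)` is trivial, then each `f g` coincides with the identity near `0`. -/
theorem germ_representation_trivial_of_linearization_trivial
    {E : Type*} [NormedAddCommGroup E] [NormedSpace ℝ E] [CompleteSpace E]
    {G : Type*} [Group G] [Group.FG G]
    (f : G → E → E)
    (hdiff : ∀ g : G, ∃ U ∈ 𝓝 (0 : E), IsOpen U ∧ ContDiffOn ℝ 1 (f g) U)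
    (hzero : ∀ g : G, f g 0 = 0)
    (hderiv : ∀ g : G, fderiv ℝ (f g) 0 = ContinuousLinearMap.id ℝ E)
    (hone : f 1 =ᶠ[𝓝 (0 : E)] id)
    (hmul : ∀ g h : G, (f g ∘ f h) =ᶠ[𝓝 (0 : E)] f (g * h))
    (hhom : ∀ φ : G → ℝ, (∀ a b : G, φ (a * b) = φ a + φ b) → ∀ g : G, φ g = 0) :
    ∀ g : G, f g =ᶠ[𝓝 (0 : E)] id := by
  have hf (g : G) : HasStrictFDerivAt (f g) (ContinuousLinearMap.id ℝ E) 0 := by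
    obtain ⟨U, hU, -, hfU⟩ := hdiff g
    exact hderiv g ▸ (hfU.contDiffAt hU).hasStrictFDerivAt one_ne_zero
  have hadd := displacement_mul_sub_isLittleO hf hzero hmul
  intro g
  by_contra hg
  obtain ⟨S, hS, hSfin⟩ := Group.fg_iff.1 ‹Group.FG G›
  have hT : Subgroup.closure (insert g S) = ⊤ :=
    top_le_iff.1 (hS ▸ Subgroup.closure_mono (Set.subset_insert g S))
  have : (𝓝 (0 : E) ⊓ 𝓟 {x | f g x ≠ x}).NeBot :=
    frequently_iff_neBot.1 (not_eventually.1 hg)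
  let U := Ultrafilter.of (𝓝 (0 : E) ⊓ 𝓟 {x | f g x ≠ x})
  have hU : (U : Filter E) ≤ 𝓝 0 := (Ultrafilter.of_le _).trans inf_le_left
  have hUg : ∀ᶠ x in (U : Filter E), f g x ≠ x :=
    ((Ultrafilter.of_le _).trans inf_le_right) (mem_principal_self _)
  obtain ⟨s, -, hs⟩ := U.exists_eventually_forall_le (hSfin.insert g) (Set.insert_nonempty g S)
    fun t x ↦ ‖f t x - x‖
  have hs_ne : ∀ᶠ x in (U : Filter E), ‖f s x - x‖ ≠ 0 := by
    filter_upwards [hUg, hs] with x hx hsx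
    exact ((norm_pos_iff.2 (sub_ne_zero.2 hx)).trans_le (hsx g (Set.mem_insert g S))).ne'
  have hbig := displacement_isBigO_of_closure_eq_top hU hone hadd hT
    (v := fun x ↦ f s x - x) fun t ht ↦ .of_bound 1 <| by
      filter_upwards [hs] with x hx
      simpa using hx t ht
  choose L hL hLs using fun x ↦ exists_dual_vector'' ℝ (f s x - x)
  have hLle (w : E → E) : (fun x ↦ L x (w x)) =O[(U : Filter E)] w :=
    .of_bound 1 <| .of_forall fun x ↦ (L x).le_of_opNorm_le (hL x) (w x)
  have hlim (a : G) : ∃ c, Tendsto (fun x ↦ L x (f a x - x) / ‖f s x - x‖) U (𝓝 c) := by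
    refine U.exists_tendsto_of_isBigO_one ?_
    refine (((hLle _).trans (hbig a)).norm_right.mul
      (isBigO_refl (fun x ↦ ‖f s x - x‖⁻¹) (U : Filter E))).trans ?_
    refine EventuallyEq.isBigO ?_
    filter_upwards [hs_ne] with x hx
    exact mul_inv_cancel₀ hx
  choose φ hφ using hlim
  have hφ_add (a b : G) : φ (a * b) = φ a + φ b := by
    have hsmall := (((hLle _).trans_isLittleO ((hadd a b).mono hU)).trans_isBigO
      (hbig b)).norm_right.tendsto_div_nhds_zero
    have hdiff_lim := ((hφ (a * b)).sub (hφ a)).sub (hφ b)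
    have := tendsto_nhds_unique hdiff_lim (hsmall.congr fun x ↦ by simp only [map_sub]; ring)
    linarith
  have hφs : φ s = 1 := by
    refine tendsto_nhds_unique (hφ s) (tendsto_const_nhds.congr' ?_)
    filter_upwards [hs_ne] with x hx
    rw [hLs]
    exact (div_self hx).symm
  exact one_ne_zero (hφs.symm.trans (hhom φ hφ_add s))
end

section
/- Let 𝒳, 𝒴, 𝒵 be real Banach spaces. Let f : 𝒴 → 𝒵 be continuously differentiable on a neighbourhood of 0 with f(0) = 0, and let f', f'' : 𝒳 → 𝒴 be continuous on a neighbourhood of 0 with f'(0) = f''(0) = 0. Assume f, f' and f'' map bounded sets to bounded sets, and that f' and f'' do not coincide on any neighbourhood of 0 (so that ‖f' − f''‖_r > 0 for every r > 0). Then limsup_{r → 0⁺} ‖f ∘ f' − f ∘ f''‖_r / ‖f' − f''‖_r ≤ ‖Df(0)‖, where Df(0) denotes the Fréchet derivative of f at 0 and the limsup is taken as r tends to 0 from the right. -/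
open Filter Topology

/-- For normed spaces `X`, `Y`, a function `h : X → Y` and `r ≥ 0`,
`‖h‖_r = sup_{‖x‖ ≤ r} ‖h x‖`. -/
noncomputable def ballSupNorm {X Y : Type*} [NormedAddCommGroup X] [NormedAddCommGroup Y]
    (h : X → Y) (r : ℝ) : ℝ :=
  sSup ((fun x => ‖h x‖) '' Metric.closedBall (0 : X) r)

lemma ballSupNorm_nonneg {X Y : Type*} [NormedAddCommGroup X] [NormedAddCommGroup Y]
    (h : X → Y) (r : ℝ) : 0 ≤ ballSupNorm h r :=
  Real.sSup_nonneg (by rintro _ ⟨x, -, rfl⟩; exact norm_nonneg _)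

lemma norm_le_ballSupNorm {X Y : Type*} [NormedAddCommGroup X] [NormedAddCommGroup Y]
    {h : X → Y} {r : ℝ} (hb : Bornology.IsBounded (h '' Metric.closedBall 0 r))
    {x : X} (hx : x ∈ Metric.closedBall 0 r) : ‖h x‖ ≤ ballSupNorm h r := by
  obtain ⟨C, hC⟩ := hb.exists_norm_le
  refine le_csSup ⟨C, ?_⟩ ⟨x, hx, rfl⟩
  rintro _ ⟨y, hy, rfl⟩
  exact hC _ ⟨y, hy, rfl⟩

/-- Composing on the left with a `K`-Lipschitz map expands `‖g - h‖_r` by at most `K`. -/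
lemma ballSupNorm_comp_sub_le {X Y Z : Type*} [NormedAddCommGroup X] [NormedAddCommGroup Y]
    [NormedAddCommGroup Z] {f : Y → Z} {g h : X → Y} {K : NNReal} {s : Set Y} {r : ℝ}
    (hf : LipschitzOnWith K f s)
    (hg : Set.MapsTo g (Metric.closedBall 0 r) s) (hh : Set.MapsTo h (Metric.closedBall 0 r) s)
    (hb : Bornology.IsBounded ((fun x => g x - h x) '' Metric.closedBall 0 r)) :
    ballSupNorm (fun x => f (g x) - f (h x)) r ≤ K * ballSupNorm (fun x => g x - h x) r := by
  refine Real.sSup_le ?_ (mul_nonneg K.2 (ballSupNorm_nonneg _ _))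
  rintro _ ⟨x, hx, rfl⟩
  calc ‖f (g x) - f (h x)‖ ≤ K * ‖g x - h x‖ := hf.norm_sub_le (hg hx) (hh hx)
    _ ≤ _ := by
      gcongr
      exact norm_le_ballSupNorm (h := fun x => g x - h x) hb hx

/-- Let `𝒳, 𝒴, 𝒵` be real Banach spaces, `f : 𝒴 → 𝒵` continuously differentiable near `0`
with `f 0 = 0`, and `f', f'' : 𝒳 → 𝒴` continuous near `0` with `f' 0 = f'' 0 = 0`, all
three mapping bounded sets to bounded sets.  If `f'` and `f''` do not coincide on any
neighbourhood of `0`, then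
`limsup_{r → 0⁺} ‖f ∘ f' − f ∘ f''‖_r / ‖f' − f''‖_r ≤ ‖Df(0)‖`. -/
theorem limsup_comp_quotient_le_norm_fderiv
    {𝒳 𝒴 𝒵 : Type*}
    [NormedAddCommGroup 𝒳] [NormedSpace ℝ 𝒳] [CompleteSpace 𝒳]
    [NormedAddCommGroup 𝒴] [NormedSpace ℝ 𝒴] [CompleteSpace 𝒴]
    [NormedAddCommGroup 𝒵] [NormedSpace ℝ 𝒵] [CompleteSpace 𝒵]
    (f : 𝒴 → 𝒵) (f' f'' : 𝒳 → 𝒴)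
    (hf : ∃ U ∈ 𝓝 (0 : 𝒴), IsOpen U ∧ ContDiffOn ℝ 1 f U) (hf0 : f 0 = 0)
    (hf' : ∃ U ∈ 𝓝 (0 : 𝒳), ContinuousOn f' U) (hf'0 : f' 0 = 0)
    (hf'' : ∃ U ∈ 𝓝 (0 : 𝒳), ContinuousOn f'' U) (hf''0 : f'' 0 = 0)
    (hfb : ∀ s : Set 𝒴, Bornology.IsBounded s → Bornology.IsBounded (f '' s))
    (hf'b : ∀ s : Set 𝒳, Bornology.IsBounded s → Bornology.IsBounded (f' '' s))
    (hf''b : ∀ s : Set 𝒳, Bornology.IsBounded s → Bornology.IsBounded (f'' '' s))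
    (hne : ¬ f' =ᶠ[𝓝 (0 : 𝒳)] f'') :
    Filter.limsup
        (fun r : ℝ =>
          ballSupNorm (fun x => f (f' x) - f (f'' x)) r /
            ballSupNorm (fun x => f' x - f'' x) r)
        (𝓝[>] (0 : ℝ)) ≤ ‖fderiv ℝ f 0‖ := by
  obtain ⟨U, hU, -, hfU⟩ := hf
  obtain ⟨V, hV, hf'V⟩ := hf'
  obtain ⟨W, hW, hf''W⟩ := hf''
  have hstrict : HasStrictFDerivAt f (fderiv ℝ f 0) 0 :=
    (hfU.contDiffAt hU).hasStrictFDerivAt one_ne_zero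
  refine le_of_forall_gt_imp_ge_of_dense fun c hc => ?_
  lift c to NNReal using (norm_nonneg _).trans hc.le
  obtain ⟨s, hs, hLip⟩ := hstrict.exists_lipschitzOnWith_of_nnnorm_lt c (by exact_mod_cast hc)
  have hs' : ∀ᶠ x in 𝓝 (0 : 𝒳), f' x ∈ s :=
    (hf'V.continuousAt hV).eventually_mem (by rwa [hf'0])
  have hs'' : ∀ᶠ x in 𝓝 (0 : 𝒳), f'' x ∈ s :=
    (hf''W.continuousAt hW).eventually_mem (by rwa [hf''0])
  obtain ⟨δ, hδ, hball⟩ := Metric.eventually_nhds_iff_ball.1 (hs'.and hs'')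
  refine limsup_le_of_le ?_ ?_
  · exact IsBoundedUnder.isCoboundedUnder_le (isBoundedUnder_of ⟨0, fun r =>
      div_nonneg (ballSupNorm_nonneg _ _) (ballSupNorm_nonneg _ _)⟩)
  · filter_upwards [Ioo_mem_nhdsGT hδ] with r hr
    have hsub : Metric.closedBall (0 : 𝒳) r ⊆ Metric.ball 0 δ :=
      Metric.closedBall_subset_ball hr.2
    refine div_le_of_le_mul₀ (ballSupNorm_nonneg _ _) c.2 (ballSupNorm_comp_sub_le hLip
      (fun x hx => (hball x (hsub hx)).1) (fun x hx => (hball x (hsub hx)).2) ?_)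
    have hB : Bornology.IsBounded (Metric.closedBall (0 : 𝒳) r) := Metric.isBounded_closedBall
    refine ((hf'b _ hB).sub (hf''b _ hB)).subset ?_
    rintro _ ⟨x, hx, rfl⟩
    exact Set.sub_mem_sub ⟨x, hx, rfl⟩ ⟨x, hx, rfl⟩
end

section
/- Let n ≥ 2 and let L₀ = { A ∈ M_n(ℝ) : dim ker A = 1 }, with the subspace topology from M_n(ℝ) ≅ ℝ^{n²}. Let L₀/SL_n(ℝ) be the quotient of L₀ by the equivalence relation A ∼ B ⟺ ∃ g ∈ SL_n(ℝ), gA = B, with the quotient topology. Then the assignment sending the class of A to the projective point determined by the one-dimensional subspace ker A ⊆ ℝⁿ is a well-defined homeomorphism from L₀/SL_n(ℝ) onto the real projective space ℝP^{n−1}. -/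
/-- The equivalence relation on the set of real `n × n` matrices of kernel dimension one
given by `A ∼ B ⟺ ∃ g ∈ SL_n(ℝ), g * A = B`. -/
def slSetoid (n : ℕ) :
    Setoid {A : Matrix (Fin n) (Fin n) ℝ //
      Module.finrank ℝ (LinearMap.ker A.mulVecLin) = 1} where
  r A B := ∃ g : Matrix (Fin n) (Fin n) ℝ,
    g.det = 1 ∧ g * (A : Matrix (Fin n) (Fin n) ℝ) = (B : Matrix (Fin n) (Fin n) ℝ)
  iseqv := by
    refine ⟨fun A => ⟨1, Matrix.det_one, one_mul _⟩, ?_, ?_⟩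
    · rintro A B ⟨g, hg, hm⟩
      refine ⟨g⁻¹, ?_, ?_⟩
      · rw [Matrix.det_nonsing_inv, hg, Ring.inverse_one]
      · rw [← hm, ← mul_assoc, Matrix.nonsing_inv_mul g (by rw [hg]; exact isUnit_one),
          one_mul]
    · rintro A B C ⟨g, hg, hm⟩ ⟨g', hg', hm'⟩
      exact ⟨g' * g, by rw [Matrix.det_mul, hg', hg, mul_one],
        by rw [mul_assoc, hm, hm']⟩

/-- The equivalence relation on `ℝⁿ ∖ {0}` identifying proportional vectors; its quotient
is the real projective space `ℝP^{n−1}`. -/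
def projSetoid (n : ℕ) : Setoid {v : Fin n → ℝ // v ≠ 0} where
  r v w := ∃ c : ℝ, c ≠ 0 ∧ c • (v : Fin n → ℝ) = (w : Fin n → ℝ)
  iseqv := by
    refine ⟨fun v => ⟨1, one_ne_zero, one_smul _ _⟩, ?_, ?_⟩
    · rintro v w ⟨c, hc, h⟩
      exact ⟨c⁻¹, inv_ne_zero hc, by rw [← h, smul_smul, inv_mul_cancel₀ hc, one_smul]⟩
    · rintro u v w ⟨c, hc, h⟩ ⟨c', hc', h'⟩
      exact ⟨c' * c, mul_ne_zero hc' hc, by rw [mul_smul, h, h']⟩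

section

open Matrix

variable {n : ℕ}

/-- The matrix of the orthogonal projection onto the hyperplane orthogonal to `v`. -/
noncomputable def hyperplaneProj (v : Fin n → ℝ) : Matrix (Fin n) (Fin n) ℝ :=
  1 - vecMulVec ((v ⬝ᵥ v)⁻¹ • v) v

theorem hyperplaneProj_mulVec (v x : Fin n → ℝ) :
    hyperplaneProj v *ᵥ x = x - ((v ⬝ᵥ x) * (v ⬝ᵥ v)⁻¹) • v := by
  simp [hyperplaneProj, sub_mulVec, smul_mulVec, vecMulVec_mulVec, smul_smul, mul_comm]

theorem hyperplaneProj_mulVec_self {v : Fin n → ℝ} (hv : v ≠ 0) :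
    hyperplaneProj v *ᵥ v = 0 := by
  have h : v ⬝ᵥ v ≠ 0 := fun h => hv (dotProduct_self_eq_zero.1 h)
  rw [hyperplaneProj_mulVec, mul_inv_cancel₀ h, one_smul, sub_self]

theorem hyperplaneProj_smul {c : ℝ} (hc : c ≠ 0) (v : Fin n → ℝ) :
    hyperplaneProj (c • v) = hyperplaneProj v := by
  ext i j
  simp only [hyperplaneProj, Matrix.sub_apply, vecMulVec_apply, dotProduct_smul, smul_dotProduct,
    Pi.smul_apply, smul_eq_mul, mul_inv]
  field_simp

theorem ker_hyperplaneProj {v : Fin n → ℝ} (hv : v ≠ 0) :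
    LinearMap.ker (hyperplaneProj v).mulVecLin = Submodule.span ℝ {v} := by
  ext x
  rw [LinearMap.mem_ker, mulVecLin_apply, Submodule.mem_span_singleton]
  constructor
  · intro h
    rw [hyperplaneProj_mulVec, sub_eq_zero] at h
    exact ⟨_, h.symm⟩
  · rintro ⟨c, rfl⟩
    rw [mulVec_smul, hyperplaneProj_mulVec_self hv, smul_zero]

theorem mul_hyperplaneProj {A : Matrix (Fin n) (Fin n) ℝ} {v : Fin n → ℝ} (hAv : A *ᵥ v = 0) :
    A * hyperplaneProj v = A := by
  simp [hyperplaneProj, mul_sub, mul_vecMulVec, hAv]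

theorem vecMulVec_mul_hyperplaneProj (w : Fin n → ℝ) {v : Fin n → ℝ} (hv : v ≠ 0) :
    vecMulVec w v * hyperplaneProj v = 0 := by
  have h : v ⬝ᵥ v ≠ 0 := fun h => hv (dotProduct_self_eq_zero.1 h)
  ext i j
  simp [hyperplaneProj, mul_sub, vecMulVec_mul_vecMulVec, vecMulVec_apply, h]

/-- A matrix whose kernel is the line through `v` is a translate of `hyperplaneProj v` under
the left action of `SL_n(ℝ)`. -/
theorem exists_det_eq_one_mul_hyperplaneProj {A : Matrix (Fin n) (Fin n) ℝ}
    (hA : Module.finrank ℝ (LinearMap.ker A.mulVecLin) = 1) {v : Fin n → ℝ} (hv : v ≠ 0)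
    (hAv : A *ᵥ v = 0) :
    ∃ g : Matrix (Fin n) (Fin n) ℝ, g.det = 1 ∧ g * hyperplaneProj v = A := by
  have hvv : v ⬝ᵥ v ≠ 0 := fun h => hv (dotProduct_self_eq_zero.1 h)
  obtain ⟨w, hw⟩ : ∃ w, ∀ x, A *ᵥ x ≠ w := by
    by_contra! hsurj
    have hinj : Function.Injective A.mulVecLin :=
      LinearMap.injective_iff_surjective.2 hsurj
    exact hv (hinj (by simpa using hAv))
  set M := A + vecMulVec w v with hM
  have hMP : M * hyperplaneProj v = A := by
    rw [hM, add_mul, vecMulVec_mul_hyperplaneProj w hv, mul_hyperplaneProj hAv, add_zero]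
  have hdet : M.det ≠ 0 := by
    intro h
    obtain ⟨x, hx, hMx⟩ := exists_mulVec_eq_zero_iff.2 h
    have hsum : A *ᵥ x + (v ⬝ᵥ x) • w = 0 := by
      simpa [hM, add_mulVec, vecMulVec_mulVec] using hMx
    have hvx : v ⬝ᵥ x = 0 := by
      by_contra hne
      apply hw (-(v ⬝ᵥ x)⁻¹ • x)
      rw [mulVec_smul, eq_neg_of_add_eq_zero_left hsum, smul_neg, neg_smul, neg_neg, smul_smul,
        inv_mul_cancel₀ hne, one_smul]
    have hAx : A *ᵥ x = 0 := by simpa [hvx] using hsum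
    obtain ⟨c, hc⟩ := (finrank_eq_one_iff_of_nonzero'
      (⟨v, hAv⟩ : LinearMap.ker A.mulVecLin) (fun h => hv (congrArg Subtype.val h))).1 hA ⟨x, hAx⟩
    have hcx : c • v = x := congrArg Subtype.val hc
    have hc0 : c = 0 := by
      rw [← hcx, dotProduct_smul, smul_eq_mul] at hvx
      exact (mul_eq_zero.1 hvx).resolve_right hvv
    exact hx (by rw [← hcx, hc0, zero_smul])
  refine ⟨M * (1 + vecMulVec (((M.det⁻¹ - 1) * (v ⬝ᵥ v)⁻¹) • v) v), ?_, ?_⟩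
  · rw [det_mul, vecMulVec_eq Unit, det_one_add_replicateCol_mul_replicateRow, dotProduct_smul,
      smul_eq_mul]
    field_simp
    ring
  · rw [Matrix.mul_assoc, add_mul (1 : Matrix _ _ ℝ), one_mul,
      vecMulVec_mul_hyperplaneProj _ hv, add_zero, hMP]

/-- The map `ℝⁿ ∖ {0} → L₀` sending `v` to `hyperplaneProj v`. -/
noncomputable def kerOneOfVector (v : {v : Fin n → ℝ // v ≠ 0}) :
    {A : Matrix (Fin n) (Fin n) ℝ // Module.finrank ℝ (LinearMap.ker A.mulVecLin) = 1} :=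
  ⟨hyperplaneProj v, by rw [ker_hyperplaneProj v.2, finrank_span_singleton v.2]⟩

theorem continuous_kerOneOfVector : Continuous (kerOneOfVector (n := n)) := by
  refine Continuous.subtype_mk ?_ _
  have hdot : Continuous fun v : {v : Fin n → ℝ // v ≠ 0} => (v : Fin n → ℝ) ⬝ᵥ v :=
    continuous_subtype_val.dotProduct continuous_subtype_val
  exact continuous_const.sub (((hdot.inv₀ fun v h => v.2 (dotProduct_self_eq_zero.1 h)).smul
    continuous_subtype_val).matrix_vecMulVec continuous_subtype_val)

/-- The map `ℝP^{n−1} → L₀/SL_n(ℝ)` sending a line to the class of matrices with that kernel. -/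
noncomputable def projToKerOneQuotient : Quotient (projSetoid n) → Quotient (slSetoid n) :=
  Quotient.lift (fun v => Quotient.mk (slSetoid n) (kerOneOfVector v)) (by
    rintro v w ⟨c, hc, h⟩
    refine congrArg _ (Subtype.ext ?_)
    simp only [kerOneOfVector, ← h, hyperplaneProj_smul hc])

theorem projToKerOneQuotient_mk_eq_mk_iff (v : {v : Fin n → ℝ // v ≠ 0})
    (A : {A : Matrix (Fin n) (Fin n) ℝ //
      Module.finrank ℝ (LinearMap.ker A.mulVecLin) = 1}) :
    projToKerOneQuotient (Quotient.mk (projSetoid n) v) = Quotient.mk (slSetoid n) A ↔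
      (A : Matrix (Fin n) (Fin n) ℝ) *ᵥ v = 0 := by
  constructor
  · intro h
    obtain ⟨g, -, hg⟩ := Quotient.exact h
    rw [← hg, ← mulVec_mulVec]
    simp only [kerOneOfVector]
    rw [hyperplaneProj_mulVec_self v.2, mulVec_zero]
  · intro h
    exact Quotient.sound (exists_det_eq_one_mul_hyperplaneProj A.2 v.2 h)

theorem continuous_projToKerOneQuotient : Continuous (projToKerOneQuotient (n := n)) :=
  (continuous_quotient_mk'.comp continuous_kerOneOfVector).quotient_lift _

theorem bijective_projToKerOneQuotient : Function.Bijective (projToKerOneQuotient (n := n)) := by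
  constructor
  · intro p q
    induction p using Quotient.inductionOn with | _ v
    induction q using Quotient.inductionOn with | _ w
    intro h
    have hv := (projToKerOneQuotient_mk_eq_mk_iff v (kerOneOfVector w)).1 h
    have hmem : (v : Fin n → ℝ) ∈ LinearMap.ker (hyperplaneProj (w : Fin n → ℝ)).mulVecLin := hv
    rw [ker_hyperplaneProj w.2, Submodule.mem_span_singleton] at hmem
    obtain ⟨c, hc⟩ := hmem
    have hc0 : c ≠ 0 := by
      rintro rfl
      exact v.2 (by rw [← hc, zero_smul])
    exact (Quotient.sound ⟨c, hc0, hc⟩ : Quotient.mk (projSetoid n) w = _).symm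
  · intro p
    induction p using Quotient.inductionOn with | _ A
    obtain ⟨v, hv, -⟩ := finrank_eq_one_iff'.1 A.2
    exact ⟨Quotient.mk _ ⟨v, fun h => hv (Subtype.ext h)⟩,
      (projToKerOneQuotient_mk_eq_mk_iff _ A).2 v.2⟩

theorem isClosedMap_projToKerOneQuotient : IsClosedMap (projToKerOneQuotient (n := n)) := by
  intro C hC
  rw [← isQuotientMap_quotient_mk'.isClosed_preimage]
  let ι : Metric.sphere (0 : Fin n → ℝ) 1 → {v : Fin n → ℝ // v ≠ 0} :=
    fun u => ⟨u, ne_zero_of_mem_unit_sphere u⟩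
  have hι : Continuous ι := continuous_subtype_val.subtype_mk _
  let S : Set ({A : Matrix (Fin n) (Fin n) ℝ //
      Module.finrank ℝ (LinearMap.ker A.mulVecLin) = 1} × Metric.sphere (0 : Fin n → ℝ) 1) :=
    {x | (x.1 : Matrix (Fin n) (Fin n) ℝ) *ᵥ (x.2 : Fin n → ℝ) = 0} ∩
      {x | Quotient.mk (projSetoid n) (ι x.2) ∈ C}
  have hS : IsClosed S := by
    refine IsClosed.inter (isClosed_eq ?_ continuous_const)
      (hC.preimage (continuous_quotient_mk'.comp (hι.comp continuous_snd)))
    exact (continuous_subtype_val.comp continuous_fst).matrix_mulVec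
      (continuous_subtype_val.comp continuous_snd)
  convert isClosedMap_fst_of_compactSpace S hS using 1
  ext A
  constructor
  · rintro ⟨p, hp, hpA⟩
    induction p using Quotient.inductionOn with | _ v
    have hA := (projToKerOneQuotient_mk_eq_mk_iff v A).1 hpA
    have hnorm : ‖(v : Fin n → ℝ)‖ ≠ 0 := norm_ne_zero_iff.2 v.2
    let u : Metric.sphere (0 : Fin n → ℝ) 1 :=
      ⟨‖(v : Fin n → ℝ)‖⁻¹ • (v : Fin n → ℝ), by simp [norm_smul, hnorm]⟩
    have hu : Quotient.mk (projSetoid n) v = Quotient.mk (projSetoid n) (ι u) :=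
      Quotient.sound ⟨_, inv_ne_zero hnorm, rfl⟩
    refine ⟨(A, u), ⟨?_, ?_⟩, rfl⟩
    · simp [u, mulVec_smul, hA]
    · rwa [hu] at hp
  · rintro ⟨⟨B, u⟩, ⟨hB, hu⟩, rfl⟩
    exact ⟨_, hu, (projToKerOneQuotient_mk_eq_mk_iff (ι u) B).2 hB⟩

end

/-- For `n ≥ 2`, the assignment sending the `SL_n(ℝ)`-class of a matrix `A` of kernel
dimension one to the projective point determined by the line `ker A ⊆ ℝⁿ` is a
well-defined homeomorphism from `L₀/SL_n(ℝ)` onto `ℝP^{n−1}`. -/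
theorem kerOneMatrices_quotient_homeomorph_projectiveSpace
    {n : ℕ} (hn : 2 ≤ n) :
    ∃ φ : Quotient (slSetoid n) ≃ₜ Quotient (projSetoid n),
      ∀ (A : {A : Matrix (Fin n) (Fin n) ℝ //
          Module.finrank ℝ (LinearMap.ker A.mulVecLin) = 1})
        (v : {v : Fin n → ℝ // v ≠ 0}),
        (v : Fin n → ℝ) ∈ LinearMap.ker (A : Matrix (Fin n) (Fin n) ℝ).mulVecLin →
        φ (Quotient.mk (slSetoid n) A) = Quotient.mk (projSetoid n) v := by
  let e := (Equiv.ofBijective _ bijective_projToKerOneQuotient).toHomeomorphOfContinuousClosed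
    (continuous_projToKerOneQuotient (n := n)) isClosedMap_projToKerOneQuotient
  refine ⟨e.symm, fun A v hv => e.symm_apply_eq.2 ?_⟩
  exact ((projToKerOneQuotient_mk_eq_mk_iff v A).2 hv).symm
end

section
/- Let n ≥ 2. For every c ∈ ℝ, the set { A ∈ M_n(ℝ) : det A = c and dim ker A ≤ 1 } is nonempty and connected (in the topology of M_n(ℝ) ≅ ℝ^{n²}). In other words, the fibers of the determinant map restricted to the open set { A : dim ker A ≤ 1 } are connected. -/
namespace Matrix

section SpecialLinear

open Matrix.SpecialLinearGroup

variable {ι : Type*} [Fintype ι] [DecidableEq ι]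

theorem SpecialLinearGroup.diag2n_eq_prod_transvection {F : Type*} [Field F] {i j : ι}
    (hij : i ≠ j) (a : F) (ha : a ≠ 0) :
    diag2n hij a ha = transvection hij a * (transvection hij.symm (-a⁻¹) *
      (transvection hij a * (transvection hij (-1) * (transvection hij.symm 1 *
        transvection hij (-1))))) := by
  ext k l
  change _ = (Matrix.transvection i j a * (Matrix.transvection j i (-a⁻¹) *
    (Matrix.transvection i j a * (Matrix.transvection i j (-1) * (Matrix.transvection j i 1 *
      Matrix.transvection i j (-1))))) : Matrix ι ι F) k l
  rw [diag2n_coe]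
  have hji := hij.symm
  have hone (i j : ι) (b : F) (k l : ι) : Matrix.transvection i j b k l =
      (if k = l then 1 else 0) + (if i = k ∧ j = l then b else 0) := by
    simp [Matrix.transvection, single_apply, one_apply]
  by_cases hki : k = i
  · subst hki
    simp only [transvection_mul_apply_same, transvection_mul_apply_of_ne, hij, hji, ne_eq,
      not_false_eq_true, hone, diagonal_apply]
    grind
  · by_cases hkj : k = j
    · subst hkj
      simp only [transvection_mul_apply_same, transvection_mul_apply_of_ne, hij, hji, ne_eq,
        not_false_eq_true, hone, diagonal_apply]
      grind
    · simp [hone, hki, hkj, diagonal_apply, Ne.symm hki]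

theorem SpecialLinearGroup.connectedSpace_real [Nontrivial ι] :
    ConnectedSpace (SpecialLinearGroup ι ℝ) := by
  rw [connectedSpace_iff_connectedComponent]
  refine ⟨1, Set.eq_univ_of_forall fun g ↦ ?_⟩
  change g ∈ Subgroup.connectedComponentOfOne (SpecialLinearGroup ι ℝ)
  have htrans (i j : ι) (hij : i ≠ j) (a : ℝ) :
      transvection hij a ∈ Subgroup.connectedComponentOfOne (SpecialLinearGroup ι ℝ) := by
    have hcont : Continuous fun b : ℝ ↦ transvection hij b := by
      refine Continuous.subtype_mk (continuous_matrix fun k l ↦ ?_) _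
      simp only [Matrix.transvection, add_apply, single_apply]
      split_ifs <;> fun_prop
    refine (isPreconnected_range hcont).subset_connectedComponent ⟨0, ?_⟩ ⟨a, rfl⟩
    exact transvection_coeff_zero hij
  refine diagonal_transvection_induction' _ g (fun i j hij a ha ↦ ?_) htrans fun _ _ ↦ mul_mem
  rw [diag2n_eq_prod_transvection]
  exact mul_mem (htrans ..) <| mul_mem (htrans ..) <| mul_mem (htrans ..) <|
    mul_mem (htrans ..) <| mul_mem (htrans ..) (htrans ..)

/-- The diagonal matrix with entry `c` at `k` and entries `1` elsewhere can be transported to any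
other position by multiplying on both sides by matrices of determinant one. -/
theorem exists_diagonal_update_eq_specialLinear_mul {R : Type*} [CommRing R] (i k : ι) (c : R) :
    ∃ P Q : SpecialLinearGroup ι R,
      diagonal (Function.update 1 k c) = (P : Matrix ι ι R) *
        diagonal (Function.update 1 i c) * Q := by
  rcases eq_or_ne i k with rfl | hik
  · exact ⟨1, 1, by simp⟩
  · set σ : Matrix ι ι R := (Equiv.swap i k).permMatrix R
    set F : Matrix ι ι R := diagonal (Function.update 1 i (-1))
    have hF : F.det = -1 := by simp [F, det_diagonal, Finset.prod_update_of_mem]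
    have hσ : σ.det = -1 := by simp [σ, det_permutation, Equiv.Perm.sign_swap hik]
    refine ⟨⟨σ * F, by simp [hF, hσ]⟩, ⟨F * σ, by simp [hF, hσ]⟩, ?_⟩
    have hFD : F * diagonal (Function.update 1 i c) * F = diagonal (Function.update 1 i c) := by
      simp only [F, diagonal_mul_diagonal]
      congr 1
      ext l
      by_cases h : l = i <;> simp [h]
    change _ = σ * F * diagonal (Function.update 1 i c) * (F * σ)
    rw [show σ * F * diagonal (Function.update 1 i c) * (F * σ) =
      σ * (F * diagonal (Function.update 1 i c) * F) * σ by simp only [Matrix.mul_assoc], hFD]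
    ext a b
    simp only [σ, PEquiv.toMatrix_toPEquiv_mul, PEquiv.mul_toMatrix_toPEquiv, submatrix_apply,
      diagonal_apply, Equiv.Perm.permMatrix, Function.update_apply, id, Equiv.symm_swap,
      EmbeddingLike.apply_eq_iff_eq, Pi.one_apply]
    congr 2
    simp [Equiv.swap_apply_eq_iff]

theorem exists_diagonal_eq_specialLinear_mul {K : Type*} [Field K] (i : ι) (d : ι → K)
    (hd : ∀ k l, d k = 0 → d l = 0 → k = l) :
    ∃ P Q : SpecialLinearGroup ι K,
      diagonal d = (P : Matrix ι ι K) * diagonal (Function.update 1 i (∏ k, d k)) * Q := by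
  obtain ⟨k, hk⟩ : ∃ k, ∀ l, l ≠ k → d l ≠ 0 := by
    by_cases h : ∃ k, d k = 0
    · obtain ⟨k, hk⟩ := h
      exact ⟨k, fun l hl h ↦ hl (hd l k h hk)⟩
    · push Not at h
      exact ⟨i, fun l _ ↦ h l⟩
  obtain ⟨P, Q, h⟩ := exists_diagonal_update_eq_specialLinear_mul i k (∏ l, d l)
  have hp : ∏ l ∈ Finset.univ \ {k}, d l ≠ 0 :=
    Finset.prod_ne_zero_iff.2 fun l hl ↦ hk l (by simpa using hl)
  let E : SpecialLinearGroup ι K :=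
    ⟨diagonal (Function.update d k (∏ l ∈ Finset.univ \ {k}, d l)⁻¹), by
      rw [det_diagonal, Finset.prod_update_of_mem (Finset.mem_univ k), inv_mul_cancel₀ hp]⟩
  refine ⟨E * P, Q, ?_⟩
  have hE : diagonal d = (E : Matrix ι ι K) * diagonal (Function.update 1 k (∏ l, d l)) := by
    simp only [E, diagonal_mul_diagonal]
    congr 1
    ext l
    by_cases hl : l = k
    · subst hl
      rw [Function.update_self, Function.update_self,
        ← Finset.mul_prod_erase _ d (Finset.mem_univ l), Finset.erase_eq, mul_left_comm,
        inv_mul_cancel₀ hp, mul_one]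
    · simp [hl]
  rw [hE, h, coe_mul]
  simp only [Matrix.mul_assoc]

end SpecialLinear

variable {ι K : Type*} [Fintype ι] [DecidableEq ι] [Field K]

theorem finrank_ker_mulVecLin_mul_mul {P Q : Matrix ι ι K} (hP : P.det ≠ 0) (hQ : Q.det ≠ 0)
    (A : Matrix ι ι K) :
    Module.finrank K (LinearMap.ker (P * A * Q).mulVecLin) =
      Module.finrank K (LinearMap.ker A.mulVecLin) := by
  have h₁ := (P * A * Q).mulVecLin.finrank_range_add_finrank_ker
  have h₂ := A.mulVecLin.finrank_range_add_finrank_ker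
  have h₃ : (P * A * Q).rank = A.rank := by
    rw [rank_mul_eq_left_of_det_ne_zero _ _ hQ, rank_mul_eq_right_of_det_ne_zero _ _ hP]
  simp only [rank] at h₃
  omega

theorem finrank_ker_mulVecLin_diagonal_le_one_iff (d : ι → K) :
    Module.finrank K (LinearMap.ker (diagonal d).mulVecLin) ≤ 1 ↔
      ∀ k l, d k = 0 → d l = 0 → k = l := by
  classical
  have h₁ := (diagonal d).mulVecLin.finrank_range_add_finrank_ker
  have h₂ := rank_diagonal d
  have h₃ := Fintype.card_subtype_compl fun k ↦ d k = 0
  have h₄ := Fintype.card_subtype_le fun k ↦ d k = 0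
  rw [Module.finrank_fintype_fun_eq_card] at h₁
  simp only [rank] at h₂
  have h : Module.finrank K (LinearMap.ker (diagonal d).mulVecLin) =
      Fintype.card {k // d k = 0} := by
    simp only [ne_eq] at h₂
    omega
  rw [h, Fintype.card_le_one_iff]
  simp only [Subtype.forall, Subtype.mk.injEq]
  exact ⟨fun h k l hk hl ↦ h k hk l hl, fun h k hk l hl ↦ h k l hk hl⟩

/-- Matrices of given determinant and with kernel of dimension at most one form a single orbit
for the two-sided action of the special linear group. -/
theorem setOf_det_eq_and_finrank_ker_le_one_eq_range (i : ι) (c : K) :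
    {A : Matrix ι ι K | A.det = c ∧ Module.finrank K (LinearMap.ker A.mulVecLin) ≤ 1} =
      Set.range fun g : SpecialLinearGroup ι K × SpecialLinearGroup ι K ↦
        (g.1 : Matrix ι ι K) * diagonal (Function.update 1 i c) * g.2 := by
  ext A
  constructor
  · rintro ⟨rfl, hA⟩
    obtain ⟨L, L', d, h⟩ := Pivot.exists_list_transvec_mul_diagonal_mul_list_transvec A
    have hL := TransvectionStruct.det_toMatrix_prod L
    have hL' := TransvectionStruct.det_toMatrix_prod L'
    have hdet : A.det = ∏ k, d k := by simp [h, hL, hL']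
    rw [h, finrank_ker_mulVecLin_mul_mul (by simp [hL]) (by simp [hL']),
      finrank_ker_mulVecLin_diagonal_le_one_iff] at hA
    obtain ⟨P, Q, hPQ⟩ := exists_diagonal_eq_specialLinear_mul i d hA
    refine ⟨(⟨_, hL⟩ * P, Q * ⟨_, hL'⟩), ?_⟩
    change _ * (P : Matrix ι ι K) * diagonal _ * ((Q : Matrix ι ι K) * _) = A
    rw [hdet, h, hPQ]
    simp only [Matrix.mul_assoc]
  · rintro ⟨⟨P, Q⟩, rfl⟩
    refine ⟨by simp [det_diagonal, Finset.prod_update_of_mem], ?_⟩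
    rw [finrank_ker_mulVecLin_mul_mul (by simp) (by simp),
      finrank_ker_mulVecLin_diagonal_le_one_iff]
    have key (k : ι) (hk : Function.update (1 : ι → K) i c k = 0) : k = i := by
      by_contra hki
      simp [hki] at hk
    exact fun k l hk hl ↦ (key k hk).trans (key l hl).symm

end Matrix

/-- For `n ≥ 2` and any `c ∈ ℝ`, the set of real `n × n` matrices `A` with `det A = c`
and `dim ker A ≤ 1` is nonempty and connected; that is, the fibers of the determinant
map restricted to the open set of matrices of kernel dimension at most one are
connected. -/
theorem isConnected_det_fiber_of_finrank_ker_le_one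
    {n : ℕ} (hn : 2 ≤ n) (c : ℝ) :
    IsConnected {A : Matrix (Fin n) (Fin n) ℝ |
      A.det = c ∧ Module.finrank ℝ (LinearMap.ker A.mulVecLin) ≤ 1} := by
  have : Nontrivial (Fin n) := Fin.nontrivial_iff_two_le.2 hn
  have := Matrix.SpecialLinearGroup.connectedSpace_real (ι := Fin n)
  rw [Matrix.setOf_det_eq_and_finrank_ker_le_one_eq_range ⟨0, by omega⟩]
  refine isConnected_range (Continuous.matrix_mul (Continuous.matrix_mul ?_ continuous_const) ?_)
  · exact continuous_subtype_val.comp continuous_fst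
  · exact continuous_subtype_val.comp continuous_snd
end
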